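/- For q = 2 and n = 3 there is no bracket μ ∈ V_{2+3} satisfying conditions (h1), (h3) and (h4); that is, there is no skew-symmetric bilinear map μ : ℝ^5 × ℝ^5 → ℝ^5 (with respect to the decomposition ℝ^5 = ℝ^2 ⊕ ℝ^3) satisfying the Jacobi identity, μ(ℝ^2,ℝ^2) ⊆ ℝ^2, μ(ℝ^2,ℝ^3) ⊆ ℝ^3, such that ad_μ z|_{ℝ^3} is skew-symmetric for every z ∈ ℝ^2, and such that z ∈ ℝ^2 with μ(z,x) = 0 for all x ∈ ℝ^3 implies z = 0. -/

import Mathlib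

open scoped BigOperators

noncomputable section

/-- Euclidean space `ℝ^m` as functions `Fin m → ℝ`. -/
abbrev Eu (m : ℕ) := Fin m → ℝ

/-- The space of bilinear maps `ℝ^{q+n} × ℝ^{q+n} → ℝ^{q+n}`. -/
abbrev Bil (q n : ℕ) := Eu (q + n) →ₗ[ℝ] Eu (q + n) →ₗ[ℝ] Eu (q + n)

/-- Skew-symmetry: membership in `V_{q+n}`. -/
def Skew (q n : ℕ) (μ : Bil q n) : Prop := ∀ x y, μ x y = - μ y x

/-- Membership in the `ℝ^q`-factor (first `q` coordinates). -/
def inK (q n : ℕ) (x : Eu (q + n)) : Prop := ∀ i : Fin (q + n), q ≤ (i : ℕ) → x i = 0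

/-- Membership in the `ℝ^n`-factor (last `n` coordinates). -/
def inP (q n : ℕ) (x : Eu (q + n)) : Prop := ∀ i : Fin (q + n), (i : ℕ) < q → x i = 0

/-- The canonical inner product. -/
def dotE (m : ℕ) (x y : Eu m) : ℝ := ∑ i, x i * y i

/-- Condition (h1): Jacobi identity, `μ(ℝ^q,ℝ^q) ⊆ ℝ^q` and `μ(ℝ^q,ℝ^n) ⊆ ℝ^n`. -/
def H1 (q n : ℕ) (μ : Bil q n) : Prop :=
  (∀ x y z, μ x (μ y z) + μ y (μ z x) + μ z (μ x y) = 0) ∧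
  (∀ x y, inK q n x → inK q n y → inK q n (μ x y)) ∧
  (∀ x y, inK q n x → inP q n y → inP q n (μ x y))

/-- Condition (h3): `ad_μ z|_{ℝ^n}` is skew-symmetric for every `z ∈ ℝ^q`. -/
def H3 (q n : ℕ) (μ : Bil q n) : Prop :=
  ∀ z x y, inK q n z → inP q n x → inP q n y →
    dotE (q + n) (μ z x) y = - dotE (q + n) x (μ z y)

/-- Condition (h4): almost-effectiveness. -/
def H4 (q n : ℕ) (μ : Bil q n) : Prop :=
  ∀ z, inK q n z → (∀ x, inP q n x → μ z x = 0) → z = 0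

/-- Inclusion `ℝ^q → ℝ^{q+n}` onto the first `q` coordinates. -/
def emK (q n : ℕ) : Eu q →ₗ[ℝ] Eu (q + n) where
  toFun z := fun i => if h : (i : ℕ) < q then z ⟨i, h⟩ else 0
  map_add' x y := by funext i; by_cases h : (i : ℕ) < q <;> simp [h]
  map_smul' c x := by funext i; by_cases h : (i : ℕ) < q <;> simp [h]

/-- Inclusion `ℝ^n → ℝ^{q+n}` onto the last `n` coordinates. -/
def emP (q n : ℕ) : Eu n →ₗ[ℝ] Eu (q + n) where
  toFun x := fun i => if h : q ≤ (i : ℕ) then x ⟨(i : ℕ) - q, by have := i.isLt; omega⟩ else 0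
  map_add' x y := by funext i; by_cases h : q ≤ (i : ℕ) <;> simp [h]
  map_smul' c x := by funext i; by_cases h : q ≤ (i : ℕ) <;> simp [h]

/-- Projection `ℝ^{q+n} → ℝ^q` (first `q` coordinates). -/
def prK (q n : ℕ) : Eu (q + n) →ₗ[ℝ] Eu q where
  toFun v := fun i => v ⟨(i : ℕ), by have := i.isLt; omega⟩
  map_add' x y := rfl
  map_smul' c x := rfl

/-- Projection `ℝ^{q+n} → ℝ^n` (last `n` coordinates). -/
def prP (q n : ℕ) : Eu (q + n) →ₗ[ℝ] Eu n where
  toFun v := fun i => v ⟨q + (i : ℕ), by have := i.isLt; omega⟩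
  map_add' x y := rfl
  map_smul' c x := rfl

/-- The restriction `ad_μ z|_{ℝ^n} : ℝ^n → ℝ^n` for `z ∈ ℝ^q`. -/
def restAdP (q n : ℕ) (μ : Bil q n) (z : Eu q) : Eu n →ₗ[ℝ] Eu n :=
  (prP q n) ∘ₗ (μ (emK q n z)) ∘ₗ (emP q n)

/-- The restriction `ad_μ z|_{ℝ^q} : ℝ^q → ℝ^q` for `z ∈ ℝ^q`. -/
def restAdK (q n : ℕ) (μ : Bil q n) (z : Eu q) : Eu q →ₗ[ℝ] Eu q :=
  (prK q n) ∘ₗ (μ (emK q n z)) ∘ₗ (emK q n)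

/-- Transpose of an endomorphism of `ℝ^n` with respect to the canonical basis. -/
def tmap (n : ℕ) (f : Eu n →ₗ[ℝ] Eu n) : Eu n →ₗ[ℝ] Eu n :=
  Matrix.toLin' (LinearMap.toMatrix' f).transpose

/-- The `GL_{q+n}(ℝ)`-action `(h.μ)(x,y) = h μ(h⁻¹x, h⁻¹y)` on brackets. -/
def act (q n : ℕ) (h : Eu (q + n) ≃ₗ[ℝ] Eu (q + n)) (μ : Bil q n) : Bil q n :=
  ((μ.comp h.symm.toLinearMap).compl₂ h.symm.toLinearMap).compr₂ h.toLinearMap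

/-- The `i`-th standard basis vector of `ℝ^{2+3}`. -/
abbrev stdVec (i : Fin (2 + 3)) : Eu (2 + 3) := Pi.single i 1

theorem inK_stdVec {i : Fin (2 + 3)} (hi : (i : ℕ) < 2) : inK 2 3 (stdVec i) := by
  intro j hj
  exact Pi.single_eq_of_ne (by rintro rfl; omega) _

theorem inP_stdVec {i : Fin (2 + 3)} (hi : 2 ≤ (i : ℕ)) : inP 2 3 (stdVec i) := by
  intro j hj
  exact Pi.single_eq_of_ne (by rintro rfl; omega) _

theorem inK_eq {z : Eu (2 + 3)} (hz : inK 2 3 z) : z = z 0 • stdVec 0 + z 1 • stdVec 1 := by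
  have h2 := hz 2 (by decide)
  have h3 := hz 3 (by decide)
  have h4 := hz 4 (by decide)
  funext i
  fin_cases i <;> simp_all [stdVec]

theorem inP_eq {x : Eu (2 + 3)} (hx : inP 2 3 x) :
    x = x 2 • stdVec 2 + x 3 • stdVec 3 + x 4 • stdVec 4 := by
  have h0 := hx 0 (by decide)
  have h1 := hx 1 (by decide)
  funext i
  fin_cases i <;> simp_all [stdVec]

theorem inK_smul_add_smul (p q : ℝ) : inK 2 3 (p • stdVec 0 + q • stdVec 1) := by
  intro i hi
  have h0 := inK_stdVec (i := 0) (by decide) i hi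
  have h1 := inK_stdVec (i := 1) (by decide) i hi
  simp [h0, h1]

/-- The matrix entries of `ad_μ z|_{ℝ^3}` are antisymmetric under (h3). -/
theorem H3.apply_stdVec {μ : Bil 2 3} (h : H3 2 3 μ) {z : Eu (2 + 3)} (hz : inK 2 3 z)
    {i j : Fin (2 + 3)} (hi : 2 ≤ (i : ℕ)) (hj : 2 ≤ (j : ℕ)) :
    μ z (stdVec i) j = - μ z (stdVec j) i := by
  have := h z _ _ hz (inP_stdVec hi) (inP_stdVec hj)
  simpa [dotE, stdVec, Pi.single_apply] using this

/-- For `z ∈ ℝ^2`, the operator `ad_μ z|_{ℝ^3}` is determined by its three entries below the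
diagonal. -/
theorem apply_stdVec_of_H1_of_H3 {μ : Bil 2 3} (h1 : H1 2 3 μ) (h3 : H3 2 3 μ)
    {z : Eu (2 + 3)} (hz : inK 2 3 z) :
    μ z (stdVec 2) = μ z (stdVec 2) 3 • stdVec 3 + μ z (stdVec 2) 4 • stdVec 4 ∧
    μ z (stdVec 3) = -μ z (stdVec 2) 3 • stdVec 2 + μ z (stdVec 3) 4 • stdVec 4 ∧
    μ z (stdVec 4) = -μ z (stdVec 2) 4 • stdVec 2 + -μ z (stdVec 3) 4 • stdVec 3 := by
  have diag : ∀ {i : Fin (2 + 3)}, 2 ≤ (i : ℕ) → μ z (stdVec i) i = 0 := fun hi => by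
    linarith [h3.apply_stdVec hz hi hi]
  have expand : ∀ {i : Fin (2 + 3)}, 2 ≤ (i : ℕ) → μ z (stdVec i) =
      μ z (stdVec i) 2 • stdVec 2 + μ z (stdVec i) 3 • stdVec 3 + μ z (stdVec i) 4 • stdVec 4 :=
    fun hi => inP_eq (h1.2.2 _ _ hz (inP_stdVec hi))
  have e2 := expand (i := 2) (by decide)
  have e3 := expand (i := 3) (by decide)
  have e4 := expand (i := 4) (by decide)
  rw [diag (i := 2) (by decide), zero_smul, zero_add] at e2
  rw [diag (i := 3) (by decide), zero_smul, add_zero,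
    h3.apply_stdVec hz (i := 3) (j := 2) (by decide) (by decide)] at e3
  rw [diag (i := 4) (by decide), zero_smul, add_zero,
    h3.apply_stdVec hz (i := 4) (j := 2) (by decide) (by decide),
    h3.apply_stdVec hz (i := 4) (j := 3) (by decide) (by decide)] at e4
  exact ⟨e2, e3, e4⟩

/-- Under (h1), (h3) and (h4), an element of `ℝ^2` whose action on `ℝ^3` has vanishing entries
below the diagonal is zero. -/
theorem eq_zero_of_entries {μ : Bil 2 3} (h1 : H1 2 3 μ) (h3 : H3 2 3 μ) (h4 : H4 2 3 μ)
    {z : Eu (2 + 3)} (hz : inK 2 3 z) (ha : μ z (stdVec 2) 3 = 0) (hb : μ z (stdVec 2) 4 = 0)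
    (hc : μ z (stdVec 3) 4 = 0) : z = 0 := by
  obtain ⟨e2, e3, e4⟩ := apply_stdVec_of_H1_of_H3 h1 h3 hz
  refine h4 z hz fun x hx => ?_
  rw [inP_eq hx, map_add, map_add, map_smul, map_smul, map_smul, e2, e3, e4, ha, hb, hc]
  simp

/-- The Jacobi identity says that `ad_μ` is a representation. -/
theorem ad_bracket {μ : Bil 2 3} (hs : Skew 2 3 μ) (h1 : H1 2 3 μ) (x y v : Eu (2 + 3)) :
    μ (μ x y) v = μ x (μ y v) - μ y (μ x v) := by
  have hJ := h1.1 x y v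
  rw [hs v x, map_neg, hs v (μ x y)] at hJ
  linear_combination -hJ

/-- If the cross product of `(a, b, c)` and `(a', b', c')` lies in their span, then it
vanishes. -/
theorem cross_eq_zero_of_mem_span {a b c a' b' c' s t : ℝ}
    (h1 : s * a + t * a' = b * c' - c * b') (h2 : s * b + t * b' = c * a' - a * c')
    (h3 : s * c + t * c' = a * b' - b * a') :
    b * c' - c * b' = 0 ∧ c * a' - a * c' = 0 ∧ a * b' - b * a' = 0 := by
  have h : (b * c' - c * b') ^ 2 + (c * a' - a * c') ^ 2 + (a * b' - b * a') ^ 2 = 0 := by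
    linear_combination -(b * c' - c * b') * h1 - (c * a' - a * c') * h2 - (a * b' - b * a') * h3
  refine ⟨?_, ?_, ?_⟩ <;> nlinarith [sq_nonneg (b * c' - c * b'), sq_nonneg (c * a' - a * c'),
    sq_nonneg (a * b' - b * a')]

/-- `ℋ_{2,3} = ∅`; there is no bracket on `ℝ^5 = ℝ^2 ⊕ ℝ^3`
satisfying (h1), (h3) and (h4). -/
theorem no_bracket_q2_n3 :
    ¬ ∃ μ : Bil 2 3, Skew 2 3 μ ∧ H1 2 3 μ ∧ H3 2 3 μ ∧ H4 2 3 μ := by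
  rintro ⟨μ, hs, h1, h3, h4⟩
  have k0 : inK 2 3 (stdVec 0) := inK_stdVec (by decide)
  have k1 : inK 2 3 (stdVec 1) := inK_stdVec (by decide)
  obtain ⟨e2, e3, e4⟩ := apply_stdVec_of_H1_of_H3 h1 h3 k0
  obtain ⟨f2, f3, f4⟩ := apply_stdVec_of_H1_of_H3 h1 h3 k1
  have hbr := inK_eq (h1.2.1 _ _ k0 k1)
  have jac := ad_bracket hs h1 (stdVec 0) (stdVec 1)
  have zero : ∀ p q : ℝ, p * μ (stdVec 0) (stdVec 2) 3 + q * μ (stdVec 1) (stdVec 2) 3 = 0 →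
      p * μ (stdVec 0) (stdVec 2) 4 + q * μ (stdVec 1) (stdVec 2) 4 = 0 →
      p * μ (stdVec 0) (stdVec 3) 4 + q * μ (stdVec 1) (stdVec 3) 4 = 0 → p = 0 ∧ q = 0 := by
    intro p q ha hb hc
    have hz := eq_zero_of_entries h1 h3 h4 (inK_smul_add_smul p q) (by simpa using ha)
      (by simpa using hb) (by simpa using hc)
    exact ⟨by simpa [stdVec] using congrFun hz 0, by simpa [stdVec] using congrFun hz 1⟩
  generalize μ (stdVec 0) (stdVec 1) 0 = s at hbr
  generalize μ (stdVec 0) (stdVec 1) 1 = t at hbr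
  have j2 := jac (stdVec 2)
  have j3 := jac (stdVec 3)
  rw [hbr] at j2 j3
  generalize μ (stdVec 0) (stdVec 2) 3 = a at *
  generalize μ (stdVec 0) (stdVec 2) 4 = b at *
  generalize μ (stdVec 0) (stdVec 3) 4 = c at *
  generalize μ (stdVec 1) (stdVec 2) 3 = a' at *
  generalize μ (stdVec 1) (stdVec 2) 4 = b' at *
  generalize μ (stdVec 1) (stdVec 3) 4 = c' at *
  simp only [map_add, map_smul, LinearMap.add_apply, LinearMap.smul_apply, e2, e3, e4, f2, f3,
    f4] at j2 j3
  have i23 := congrFun j2 3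
  have i24 := congrFun j2 4
  have i34 := congrFun j3 4
  simp [stdVec] at i23 i24 i34
  obtain ⟨n1, n2, n3⟩ := cross_eq_zero_of_mem_span (a := a) (b := b) (c := c) (a' := a')
    (b' := b') (c' := c') (s := s) (t := t) (by linarith) (by linarith) (by linarith)
  have ha : a = 0 := neg_eq_zero.mp (zero a' (-a) (by ring) (by linarith) (by linarith)).2
  have hb : b = 0 := neg_eq_zero.mp (zero b' (-b) (by linarith) (by ring) (by linarith)).2
  have hc : c = 0 := neg_eq_zero.mp (zero c' (-c) (by linarith) (by linarith) (by ring)).2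
  exact one_ne_zero (zero 1 0 (by simp [ha]) (by simp [hb]) (by simp [hc])).1
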